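/- Let Φ denote the standard normal CDF, logit(p) = log p − log(1−p) for p ∈ (0,1), and let a_L < a_U < 0 and b be real constants. Define f(t) = Φ(a_U√t + b) − Φ(a_L√t + b) for t > 0. Then f(t) ∈ (0,1) for all t > 0, the function g(t) = logit(f(t)) is differentiable for sufficiently large t, and lim_{t→∞} g′(t) = −a_U²/2 = −min{a_U², a_L²}/2. (This is Theorem 1(b) of the paper in the case θ > δ_U, so the hypothesis H_{1,k} is false.) -/

import Mathlib

open Filter Real

/-- The standard normal CDF: Φ(x) = ∫_{−∞}^{x} e^{−t²/2}/√(2π) dt. -/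
noncomputable def stdNormCDF (x : ℝ) : ℝ :=
  ∫ t in Set.Iic x, Real.exp (-t ^ 2 / 2) / Real.sqrt (2 * Real.pi)

/-- logit(p) = log p − log(1−p). -/
noncomputable def logit (p : ℝ) : ℝ := Real.log p - Real.log (1 - p)

/-- The standard normal density. -/
noncomputable def stdNormPDF (x : ℝ) : ℝ := Real.exp (-x ^ 2 / 2) / Real.sqrt (2 * Real.pi)

theorem stdNormPDF_pos (x : ℝ) : 0 < stdNormPDF x := by
  unfold stdNormPDF
  positivity

theorem stdNormPDF_le_one (x : ℝ) : stdNormPDF x ≤ 1 := by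
  unfold stdNormPDF
  have hexp : Real.exp (-x ^ 2 / 2) ≤ 1 := by
    rw [Real.exp_le_one_iff]
    nlinarith [sq_nonneg x]
  have hsqrt : 1 ≤ Real.sqrt (2 * Real.pi) := by
    rw [Real.one_le_sqrt]
    nlinarith [Real.pi_gt_three]
  rw [div_le_one (by positivity)]
  exact hexp.trans hsqrt

theorem stdNormPDF_eq_gaussianPDFReal :
    stdNormPDF = ProbabilityTheory.gaussianPDFReal 0 1 := by
  funext x
  simp [stdNormPDF, ProbabilityTheory.gaussianPDFReal, div_eq_inv_mul]

theorem stdNormCDF_eq_cdf (x : ℝ) :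
    stdNormCDF x = ProbabilityTheory.cdf (ProbabilityTheory.gaussianReal 0 1) x := by
  rw [ProbabilityTheory.cdf_eq_real, MeasureTheory.measureReal_def,
    ProbabilityTheory.gaussianReal_apply_eq_integral 0 one_ne_zero,
    ENNReal.toReal_ofReal (MeasureTheory.integral_nonneg fun y =>
      ProbabilityTheory.gaussianPDFReal_nonneg 0 1 y),
    ← stdNormPDF_eq_gaussianPDFReal]
  rfl

theorem continuous_stdNormPDF : Continuous stdNormPDF := by
  unfold stdNormPDF
  fun_prop

theorem integrable_stdNormPDF : MeasureTheory.Integrable stdNormPDF := by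
  rw [stdNormPDF_eq_gaussianPDFReal]
  exact ProbabilityTheory.integrable_gaussianPDFReal 0 1

theorem hasDerivAt_stdNormCDF (x : ℝ) : HasDerivAt stdNormCDF (stdNormPDF x) x := by
  have hsplit : stdNormCDF = fun y => (∫ t in (0 : ℝ)..y, stdNormPDF t) + stdNormCDF 0 := by
    funext y
    rw [← intervalIntegral.integral_Iic_sub_Iic integrable_stdNormPDF.integrableOn
      integrable_stdNormPDF.integrableOn]
    simp [stdNormCDF, stdNormPDF]
  rw [hsplit]
  exact (continuous_stdNormPDF.integral_hasStrictDerivAt 0 x).hasDerivAt.add_const _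

theorem strictMono_stdNormCDF : StrictMono stdNormCDF :=
  strictMono_of_hasDerivAt_pos hasDerivAt_stdNormCDF stdNormPDF_pos

theorem stdNormCDF_sub_mem_Ioo {x y : ℝ} (h : x < y) :
    stdNormCDF y - stdNormCDF x ∈ Set.Ioo (0 : ℝ) 1 := by
  have hlt := strictMono_stdNormCDF h
  have hlt' := strictMono_stdNormCDF (lt_add_one y)
  have hle : stdNormCDF (y + 1) ≤ 1 := by
    rw [stdNormCDF_eq_cdf]
    exact ProbabilityTheory.cdf_le_one _ _
  have hnonneg : 0 ≤ stdNormCDF x := by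
    rw [stdNormCDF_eq_cdf]
    exact ProbabilityTheory.cdf_nonneg _ _
  exact ⟨by linarith, by linarith⟩

theorem tendsto_stdNormCDF_atBot : Tendsto stdNormCDF atBot (nhds 0) := by
  rw [funext stdNormCDF_eq_cdf]
  exact ProbabilityTheory.tendsto_cdf_atBot _

theorem hasDerivAt_stdNormPDF (x : ℝ) : HasDerivAt stdNormPDF (-x * stdNormPDF x) x := by
  have h : HasDerivAt (fun y : ℝ => -y ^ 2 / 2) (-x) x := by
    refine ((hasDerivAt_pow 2 x).neg.div_const 2).congr_deriv ?_
    norm_num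
    ring
  refine (h.exp.div_const (Real.sqrt (2 * Real.pi))).congr_deriv ?_
  rw [stdNormPDF]
  ring

theorem tendsto_affine_atBot {a : ℝ} (ha : a < 0) (b : ℝ) :
    Tendsto (fun s : ℝ => a * s + b) atTop atBot :=
  tendsto_atBot_add_const_right _ _ (tendsto_id.const_mul_atTop_of_neg ha)

theorem hasDerivAt_affine (a b s : ℝ) : HasDerivAt (fun s : ℝ => a * s + b) a s := by
  simpa using ((hasDerivAt_id s).const_mul a).add_const b

/-- Along two affine functions with negative slopes, the density along the steeper one is
negligible. -/
theorem tendsto_stdNormPDF_div {aL aU : ℝ} (b : ℝ) (haLU : aL < aU) (haU : aU < 0) :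
    Tendsto (fun s : ℝ => stdNormPDF (aL * s + b) / stdNormPDF (aU * s + b)) atTop (nhds 0) := by
  have heq : (fun s : ℝ => stdNormPDF (aL * s + b) / stdNormPDF (aU * s + b)) =
      fun s => Real.exp ((aU - aL) / 2 * s * ((aL + aU) * s + 2 * b)) := by
    funext s
    have hsqrt : Real.sqrt (2 * Real.pi) ≠ 0 := by positivity
    rw [stdNormPDF, stdNormPDF, div_div_div_cancel_right₀ hsqrt, ← Real.exp_sub]
    congr 1
    ring
  rw [heq]
  refine Real.tendsto_exp_atBot.comp ?_
  exact (tendsto_id.const_mul_atTop (by linarith)).atTop_mul_atBot₀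
    (tendsto_affine_atBot (by linarith) _)

theorem hasDerivAt_stdNormCDF_affine (a b s : ℝ) :
    HasDerivAt (fun s : ℝ => stdNormCDF (a * s + b)) (stdNormPDF (a * s + b) * a) s :=
  HasDerivAt.comp (h₂ := stdNormCDF) s (hasDerivAt_stdNormCDF (a * s + b))
    (hasDerivAt_affine a b s)

/-- Mills-ratio asymptotics for the Gaussian mass of an interval escaping to `-∞`. -/
theorem tendsto_stdNormCDF_sub_div {aL aU : ℝ} (b : ℝ) (haLU : aL < aU) (haU : aU < 0) :
    Tendsto (fun s : ℝ => (stdNormCDF (aU * s + b) - stdNormCDF (aL * s + b)) /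
      (stdNormPDF (aU * s + b) / s)) atTop (nhds (-aU)⁻¹) := by
  have hinv : Tendsto (fun s : ℝ => s⁻¹) atTop (nhds 0) := tendsto_inv_atTop_zero
  have hfactor : Tendsto (fun s : ℝ => -(aU + b * s⁻¹) * aU - s⁻¹ * s⁻¹) atTop
      (nhds (-aU ^ 2)) := by
    have h := ((((hinv.const_mul b).const_add aU).neg).mul_const aU).sub (hinv.mul hinv)
    convert h using 2
    ring
  have hsq : -aU ^ 2 ≠ 0 := neg_ne_zero.mpr (pow_ne_zero 2 haU.ne)
  refine HasDerivAt.lhopital_zero_atTop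
    (f' := fun s => stdNormPDF (aU * s + b) * aU - stdNormPDF (aL * s + b) * aL)
    (g' := fun s => stdNormPDF (aU * s + b) * (-(aU + b * s⁻¹) * aU - s⁻¹ * s⁻¹))
    ?_ ?_ ?_ ?_ ?_ ?_
  · exact .of_forall fun s =>
      (hasDerivAt_stdNormCDF_affine aU b s).sub (hasDerivAt_stdNormCDF_affine aL b s)
  · filter_upwards [eventually_gt_atTop 0] with s hs
    refine ((HasDerivAt.comp (h₂ := stdNormPDF) s (hasDerivAt_stdNormPDF (aU * s + b))
      (hasDerivAt_affine aU b s)).div (hasDerivAt_id s) hs.ne').congr_deriv ?_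
    simp only [id, Function.comp]
    field_simp
  · filter_upwards [hfactor.eventually_ne hsq] with s hs
    exact mul_ne_zero (stdNormPDF_pos _).ne' hs
  · simpa using (tendsto_stdNormCDF_atBot.comp (tendsto_affine_atBot haU b)).sub
      (tendsto_stdNormCDF_atBot.comp (tendsto_affine_atBot (haLU.trans haU) b))
  · refine squeeze_zero' ?_ ?_ hinv
    · filter_upwards [eventually_gt_atTop 0] with s hs
      exact (div_pos (stdNormPDF_pos _) hs).le
    · filter_upwards [eventually_gt_atTop 0] with s hs
      rw [inv_eq_one_div]
      gcongr
      exact stdNormPDF_le_one _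
  · have h := (((tendsto_stdNormPDF_div b haLU haU).mul_const aL).const_sub aU).div hfactor hsq
    have hlim : (aU - 0 * aL) / -aU ^ 2 = (-aU)⁻¹ := by
      have := haU.ne
      field_simp
      ring
    rw [hlim] at h
    refine h.congr fun s => ?_
    have hpos := (stdNormPDF_pos (aU * s + b)).ne'
    simp only [Pi.div_apply]
    rw [← mul_div_mul_left _ _ hpos]
    congr 1
    field_simp

theorem hasDerivAt_logit {p : ℝ} (hp : p ∈ Set.Ioo (0 : ℝ) 1) :
    HasDerivAt logit (p⁻¹ + (1 - p)⁻¹) p := by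
  have h1 := Real.hasDerivAt_log hp.1.ne'
  have h2 := ((hasDerivAt_id p).const_sub 1).log (sub_pos.mpr hp.2).ne'
  refine (h1.sub h2).congr_deriv ?_
  simp only [id]
  ring

/-- For a_L < a_U < 0 and b real, f(t) = Φ(a_U√t + b) − Φ(a_L√t + b) lies in
(0,1) for all t > 0, g(t) = logit(f(t)) is differentiable for sufficiently
large t, and lim_{t→∞} g′(t) = −a_U²/2 = −min{a_U², a_L²}/2. -/
theorem stmt8 (aL aU b : ℝ) (haLU : aL < aU) (haU : aU < 0) :
    (∀ t : ℝ, 0 < t →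
        stdNormCDF (aU * Real.sqrt t + b) - stdNormCDF (aL * Real.sqrt t + b) ∈
          Set.Ioo (0 : ℝ) 1) ∧
      (∀ᶠ t : ℝ in atTop,
        DifferentiableAt ℝ
          (fun t : ℝ =>
            logit (stdNormCDF (aU * Real.sqrt t + b) - stdNormCDF (aL * Real.sqrt t + b))) t) ∧
      Tendsto
        (deriv fun t : ℝ =>
          logit (stdNormCDF (aU * Real.sqrt t + b) - stdNormCDF (aL * Real.sqrt t + b)))
        atTop (nhds (-aU ^ 2 / 2)) ∧
      -aU ^ 2 / 2 = -min (aU ^ 2) (aL ^ 2) / 2 := by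
  have hmem : ∀ t : ℝ, 0 < t →
      stdNormCDF (aU * Real.sqrt t + b) - stdNormCDF (aL * Real.sqrt t + b) ∈
        Set.Ioo (0 : ℝ) 1 := by
    intro t ht
    apply stdNormCDF_sub_mem_Ioo
    have := mul_lt_mul_of_pos_right haLU (Real.sqrt_pos.mpr ht)
    linarith
  have hderiv : ∀ t : ℝ, 0 < t → HasDerivAt
      (fun t : ℝ =>
        logit (stdNormCDF (aU * Real.sqrt t + b) - stdNormCDF (aL * Real.sqrt t + b)))
      (((stdNormCDF (aU * Real.sqrt t + b) - stdNormCDF (aL * Real.sqrt t + b))⁻¹ +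
        (1 - (stdNormCDF (aU * Real.sqrt t + b) - stdNormCDF (aL * Real.sqrt t + b)))⁻¹) *
        ((stdNormPDF (aU * Real.sqrt t + b) * aU - stdNormPDF (aL * Real.sqrt t + b) * aL) *
          (1 / (2 * Real.sqrt t)))) t := by
    intro t ht
    have hF := HasDerivAt.comp
      (h₂ := fun s : ℝ => stdNormCDF (aU * s + b) - stdNormCDF (aL * s + b)) t
      ((hasDerivAt_stdNormCDF_affine aU b _).sub (hasDerivAt_stdNormCDF_affine aL b _))
      (Real.hasDerivAt_sqrt ht.ne')
    exact HasDerivAt.comp (h₂ := logit) t (hasDerivAt_logit (hmem t ht)) hF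
  refine ⟨hmem, ?_, ?_, ?_⟩
  · filter_upwards [eventually_gt_atTop 0] with t ht
    exact (hderiv t ht).differentiableAt
  · have hF : Tendsto (fun s : ℝ => stdNormCDF (aU * s + b) - stdNormCDF (aL * s + b)) atTop
        (nhds 0) := by
      simpa using (tendsto_stdNormCDF_atBot.comp (tendsto_affine_atBot haU b)).sub
        (tendsto_stdNormCDF_atBot.comp (tendsto_affine_atBot (haLU.trans haU) b))
    have hlim := ((((tendsto_stdNormCDF_sub_div b haLU haU).inv₀
      (inv_ne_zero (neg_ne_zero.mpr haU.ne))).mul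
      ((((tendsto_stdNormPDF_div b haLU haU).mul_const aL).const_sub aU).div_const 2)).mul
      ((hF.mul ((hF.const_sub 1).inv₀ (by norm_num))).const_add 1)).comp Real.tendsto_sqrt_atTop
    have hval : ((-aU)⁻¹)⁻¹ * ((aU - 0 * aL) / 2) * (1 + 0 * (1 - 0)⁻¹) = -aU ^ 2 / 2 := by
      rw [inv_inv]
      ring
    rw [hval] at hlim
    refine hlim.congr' ?_
    filter_upwards [eventually_gt_atTop 0] with t ht
    rw [(hderiv t ht).deriv]
    have hs := (Real.sqrt_pos.mpr ht).ne'
    have hp := (hmem t ht).1.ne'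
    have hpdf := (stdNormPDF_pos (aU * Real.sqrt t + b)).ne'
    simp only [Function.comp]
    generalize stdNormCDF (aU * Real.sqrt t + b) - stdNormCDF (aL * Real.sqrt t + b) = p at hp ⊢
    generalize (1 - p)⁻¹ = q
    field_simp
  · rw [min_eq_left (by nlinarith)]
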